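/- arXiv:1805.03165 — 3 statements merged into one kernel-verified Lean document; each statement's English description precedes it below -/
import Mathlib

section
/- Let q be a prime with q ≡ 1 (mod 3). If there exists a family of q-product blocks B_0, B_1, ..., B_{q-1} whose total size (the sum of the cardinalities of all blocks) equals v, then there exists a set S of permutations of {0, 1, ..., q-1} with |S| ≥ (q-1)(v+q) such that any two distinct permutations in S differ in at least q-3 positions. -/
open Finset in
theorem card_filter_quadratic_le {K : Type*} [Field K] [Fintype K] [DecidableEq K] (α β γ : K)
    (h : ¬(α = 0 ∧ β = 0 ∧ γ = 0)) :
    (univ.filter fun x : K => α * x ^ 2 + β * x + γ = 0).card ≤ 2 := by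
  open Polynomial in
  set p : K[X] := C α * X ^ 2 + C β * X + C γ with hp
  have hp0 : p ≠ 0 := fun h0 => h
    ⟨by simpa [hp, coeff_X, coeff_C] using congrArg (coeff · 2) h0,
      by simpa [hp, coeff_X, coeff_C] using congrArg (coeff · 1) h0,
      by simpa [hp, coeff_X, coeff_C] using congrArg (coeff · 0) h0⟩
  calc (univ.filter fun x : K => α * x ^ 2 + β * x + γ = 0).card
      ≤ p.roots.toFinset.card := card_le_card fun x hx => by
        rw [Multiset.mem_toFinset, mem_roots hp0]
        simpa [hp] using hx
    _ ≤ p.roots.card := p.roots.toFinset_card_le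
    _ ≤ p.natDegree := p.card_roots'
    _ ≤ 2 := natDegree_quadratic_le

open Finset in
theorem card_filter_eq_le_three {K : Type*} [Field K] [Fintype K] [DecidableEq K] {f g : K → K}
    (p α β γ : K) (h : ¬(α = 0 ∧ β = 0 ∧ γ = 0))
    (hfg : ∀ x, x ≠ p → f x = g x → α * x ^ 2 + β * x + γ = 0) :
    (univ.filter fun x => f x = g x).card ≤ 3 := by
  refine (card_le_card (t := insert p (univ.filter fun x : K => α * x ^ 2 + β * x + γ = 0))
    fun x hx => ?_).trans ((card_insert_le _ _).trans
      (Nat.succ_le_succ (card_filter_quadratic_le α β γ h)))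
  by_cases hxp : x = p
  · simp [hxp]
  · simpa [hxp] using hfg x hxp (by simpa using hx)

/-- The permutation `x ↦ r * x + b`. -/
def affinePerm {K : Type*} [Field K] (r : Kˣ) (b : K) : Equiv.Perm K :=
  (Units.mulLeft r).trans (Equiv.addRight b)

/-- The permutation `x ↦ r * (a + 1 / (x - s))`, where the pole `s` is sent to `r * a`, the value
of the fractional linear map at infinity. -/
def contractedPerm {K : Type*} [Field K] (r : Kˣ) (s a : K) : Equiv.Perm K :=
  (Equiv.subRight s).trans
    ((Equiv.inv K).trans ((Equiv.addLeft a).trans (Units.mulLeft r)))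

@[simp]
theorem affinePerm_apply {K : Type*} [Field K] (r : Kˣ) (b x : K) :
    affinePerm r b x = r * x + b := rfl

@[simp]
theorem contractedPerm_apply {K : Type*} [Field K] (r : Kˣ) (s a x : K) :
    contractedPerm r s a x = r * (a + (x - s)⁻¹) := rfl

section Agreement

variable {K : Type*} [Field K] [Fintype K] [DecidableEq K]

open Finset

theorem card_affinePerm_eq_affinePerm_le {r r' : Kˣ} {b b' : K} (h : ¬(r = r' ∧ b = b')) :
    (univ.filter fun x => affinePerm r b x = affinePerm r' b' x).card ≤ 3 := by
  refine card_filter_eq_le_three 0 0 (r - r' : K) (b - b') ?_ fun x _ hx => ?_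
  · rintro ⟨-, h1, h2⟩
    exact h ⟨Units.ext (sub_eq_zero.1 h1), sub_eq_zero.1 h2⟩
  · simp only [affinePerm_apply] at hx
    linear_combination hx

theorem card_affinePerm_eq_contractedPerm_le (r r' : Kˣ) (b s a : K) :
    (univ.filter fun x => affinePerm r b x = contractedPerm r' s a x).card ≤ 3 := by
  refine card_filter_eq_le_three s r (b - r * s - r' * a) (r' * a * s - b * s - r')
    (fun h => r.ne_zero h.1) fun x hxs hx => ?_
  simp only [affinePerm_apply, contractedPerm_apply] at hx
  have hinv := inv_mul_cancel₀ (sub_ne_zero.2 hxs)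
  linear_combination (x - s) * hx + r' * hinv

theorem card_contractedPerm_eq_contractedPerm_le {r r' : Kˣ} {s s' a a' : K}
    (h : ¬(r = r' ∧ s = s' ∧ a = a')) (hprod : (a - a') * (s - s') ≠ 1) :
    (univ.filter fun x => contractedPerm r s a x = contractedPerm r' s' a' x).card ≤ 3 := by
  by_cases hs : s = s'
  · subst hs
    refine card_filter_eq_le_three s 0 (r * a - r' * a' : K)
      (r - r' - (r * a - r' * a') * s : K) ?_ fun x hxs hx => ?_
    · rintro ⟨-, h1, h2⟩
      have hr : r = r' := Units.ext (by linear_combination h2 + s * h1)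
      subst hr
      exact h ⟨rfl, rfl, mul_left_cancel₀ r.ne_zero (sub_eq_zero.1 h1)⟩
    · simp only [contractedPerm_apply] at hx
      have hinv := inv_mul_cancel₀ (sub_ne_zero.2 hxs)
      linear_combination (x - s) * hx + (r' - r : K) * hinv
  have hss := sub_ne_zero.2 hs
  have hquad : ∀ x, x ≠ s → x ≠ s' →
      contractedPerm r s a x = contractedPerm r' s' a' x →
      (r * a - r' * a' : K) * x ^ 2 + (r - r' - (r * a - r' * a') * (s + s') : K) * x
        + ((r * a - r' * a') * s * s' - r * s' + r' * s : K) = 0 := by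
    intro x hxs hxs' hx
    simp only [contractedPerm_apply] at hx
    have hinv := inv_mul_cancel₀ (sub_ne_zero.2 hxs)
    have hinv' := inv_mul_cancel₀ (sub_ne_zero.2 hxs')
    linear_combination (x - s) * (x - s') * hx - r * (x - s') * hinv + r' * (x - s) * hinv'
  have hne : ¬((r * a - r' * a' : K) = 0 ∧ (r - r' - (r * a - r' * a') * (s + s') : K) = 0 ∧
      ((r * a - r' * a') * s * s' - r * s' + r' * s : K) = 0) := by
    rintro ⟨h1, h2, h3⟩
    exact mul_ne_zero r.ne_zero hss (by linear_combination s ^ 2 * h1 + s * h2 + h3)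
  by_cases hs1 : contractedPerm r s a s = contractedPerm r' s' a' s
  · refine card_filter_eq_le_three s _ _ _ hne fun x hxs hx => hquad x hxs ?_ hx
    rintro rfl
    simp only [contractedPerm_apply, sub_self, inv_zero, add_zero] at hs1 hx
    rw [← neg_sub s x, inv_neg] at hx
    have hinv := inv_mul_cancel₀ hss
    have hr : r = r' := Units.ext (by
      linear_combination (s - x) * (hs1 - hx) + (r' - r : K) * hinv)
    subst hr
    have ha := mul_left_cancel₀ r.ne_zero hs1
    exact hprod (by linear_combination (s - x) * ha + hinv)
  · refine card_filter_eq_le_three s' _ _ _ hne fun x hxs' hx => hquad x ?_ hxs' hx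
    rintro rfl
    exact hs1 hx

/-- The affine permutations together with the contracted fractional linear permutations whose
pole `s` and normalised value `a` at infinity satisfy `a ∈ B s`. -/
def blockPerm (B : K → Finset K) : (Kˣ × K) ⊕ (Kˣ × (s : K) × B s) → Equiv.Perm K :=
  Sum.elim (fun t => affinePerm t.1 t.2) (fun t => contractedPerm t.1 t.2.1 t.2.2)

theorem card_blockPerm_eq_blockPerm_le {B : K → Finset K}
    (hB : ∀ r s : K, ∀ a ∈ B r, ∀ b ∈ B s, (b - a) * (s - r) ≠ 1)
    {t t' : (Kˣ × K) ⊕ (Kˣ × (s : K) × B s)} (h : t ≠ t') :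
    (univ.filter fun x => blockPerm B t x = blockPerm B t' x).card ≤ 3 := by
  rcases t with ⟨r, b⟩ | ⟨r, s, a, ha⟩ <;> rcases t' with ⟨r', b'⟩ | ⟨r', s', a', ha'⟩
  · refine card_affinePerm_eq_affinePerm_le ?_
    rintro ⟨rfl, rfl⟩
    exact h rfl
  · exact card_affinePerm_eq_contractedPerm_le r r' b s' a'
  · simp only [eq_comm (a := blockPerm B (Sum.inr _) _)]
    exact card_affinePerm_eq_contractedPerm_le r' r b' s a
  · refine card_contractedPerm_eq_contractedPerm_le ?_ (hB s' s a' ha' a ha)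
    rintro ⟨rfl, rfl, rfl⟩
    exact h rfl

theorem blockPerm_injective {B : K → Finset K}
    (hB : ∀ r s : K, ∀ a ∈ B r, ∀ b ∈ B s, (b - a) * (s - r) ≠ 1) (hK : 3 < Fintype.card K) :
    Function.Injective (blockPerm B) := by
  intro t t' htt
  by_contra hne
  have := card_blockPerm_eq_blockPerm_le hB hne
  simp only [htt, filter_true, card_univ] at this
  omega

end Agreement

/-- **Theorem 1.** Let `q` be a prime with `q ≡ 1 (mod 3)`. If there exists a family of
`q`-product blocks `B_0, …, B_{q-1}` (subsets of `ZMod q` with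
`(b - a) * (s - r) ≠ 1` for all `a ∈ B r`, `b ∈ B s`) of total size `v`, then
`M(q, q-3) ≥ (q-1)(v+q)`: there is a set of at least `(q-1)(v+q)` permutations of
`{0, …, q-1}` any two distinct members of which differ in at least `q - 3` positions. -/
theorem product_blocks_lower_bound (q v : ℕ) [Fact q.Prime] (h3 : q % 3 = 1)
    (B : ZMod q → Finset (ZMod q))
    (hPB : ∀ r s : ZMod q, ∀ a ∈ B r, ∀ b ∈ B s, (b - a) * (s - r) ≠ 1)
    (hv : ∑ s : ZMod q, (B s).card = v) :
    ∃ S : Finset (Equiv.Perm (Fin q)),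
      (q - 1) * (v + q) ≤ S.card ∧
      ∀ σ ∈ S, ∀ τ ∈ S, σ ≠ τ →
        q - 3 ≤ (Finset.univ.filter (fun x => σ x ≠ τ x)).card := by
  have hq : 3 < q := by
    have := (Fact.out : q.Prime).two_le
    omega
  let e : ZMod q ≃ Fin q := Fintype.equivFinOfCardEq (ZMod.card q)
  have hinj : Function.Injective fun t => e.permCongr (blockPerm B t) :=
    e.permCongr.injective.comp (blockPerm_injective hPB (by rwa [ZMod.card]))
  refine ⟨Finset.univ.map ⟨_, hinj⟩, ?_, ?_⟩
  · have hcard : Fintype.card ((ZMod q)ˣ × ZMod q ⊕ (ZMod q)ˣ × (s : ZMod q) × B s)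
        = (q - 1) * (v + q) := by
      simp only [Fintype.card_sum, Fintype.card_prod, Fintype.card_sigma, Fintype.card_coe, hv,
        ZMod.card_units, ZMod.card]
      ring
    rw [Finset.card_map, Finset.card_univ, hcard]
  · simp only [Finset.mem_map, Finset.mem_univ, true_and, Function.Embedding.coeFn_mk]
    rintro _ ⟨t, rfl⟩ _ ⟨t', rfl⟩ hne
    have hle := card_blockPerm_eq_blockPerm_le hPB (fun h : t = t' => hne (by rw [h]))
    have hsum := Finset.card_filter_add_card_filter_not (s := (Finset.univ : Finset (Fin q)))
      (fun x => e.permCongr (blockPerm B t) x = e.permCongr (blockPerm B t') x)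
    have heq : (Finset.univ.filter fun x =>
        e.permCongr (blockPerm B t) x = e.permCongr (blockPerm B t') x).card
          = (Finset.univ.filter fun x => blockPerm B t x = blockPerm B t' x).card :=
      Finset.card_equiv e.symm (by simp)
    rw [Finset.card_univ, Fintype.card_fin] at hsum
    change q - 3 ≤ (Finset.univ.filter fun x =>
      ¬ e.permCongr (blockPerm B t) x = e.permCongr (blockPerm B t') x).card
    omega
end

section
/- Let F be a finite field and let (B_s)_{s ∈ F} be a family of q-product blocks over F. If there exists an element a ∈ F with a ∈ B_s for every s ∈ F, then B_s = {a} for every s ∈ F. -/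
/-- If all blocks of a family of product blocks over a finite field `F` share a common
element `a`, then every block equals `{a}`. -/
theorem product_blocks_common_element (F : Type*) [Field F] [Fintype F]
    (B : F → Finset F)
    (hPB : ∀ r s : F, ∀ a ∈ B r, ∀ b ∈ B s, (b - a) * (s - r) ≠ 1)
    (a : F) (ha : ∀ s : F, a ∈ B s) :
    ∀ s : F, B s = {a} := by
  intro s
  refine Finset.eq_singleton_iff_unique_mem.mpr ⟨ha s, fun b hb => ?_⟩
  by_contra hne
  refine hPB (s - (b - a)⁻¹) s a (ha _) b hb ?_
  rw [sub_sub_cancel]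
  exact mul_inv_cancel₀ (sub_ne_zero.mpr hne)
end

section
/- The blocks B_0 = {7,10,13,16,19}, B_1 = {15,18,21,24,27}, B_2 = {0,3,6,23,26}, B_3 = {2,5,8,11,14}, B_4 = {10,13,16,19,22}, B_5 = {1,18,21,24,27}, B_6 = {0,3,6,9,26}, B_7 = {5,8,11,14,17}, B_8 = {13,16,19,22,25}, B_9 = {1,4,21,24,27}, B_10 = {0,3,6,9,12}, B_11 = {8,11,14,17,20}, B_12 = {16,19,22,25,28}, B_13 = {1,4,7,24,27}, B_14 = {3,6,9,12,15}, B_15 = {11,14,17,20,23}, B_16 = {2,19,22,25,28}, B_17 = {1,4,7,10,27}, B_18 = {6,9,12,15,18}, B_19 = {14,17,20,23,26}, B_20 = {2,5,22,25,28}, B_21 = {1,4,7,10,13}, B_22 = {9,12,15,18,21}, B_23 = {0,17,20,23,26}, B_24 = {2,5,8,25,28}, B_25 = {4,7,10,13,16}, B_26 = {12,15,18,21,24}, B_27 = {0,3,20,23,26}, B_28 = {2,5,8,11,28} form a family of 29-product blocks over ZMod 29 in which every block has exactly 5 elements; hence κ(29) ≥ 5. -/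
/-- Blocks that are arithmetic progressions of length 5 with difference 3, starting at
`7 + 8 * s`, have no two points at reciprocal differences. -/
lemma mul_progression_sub_ne_one (d : ZMod 29) (i j : Fin 5) :
    (8 * d + 3 * ((j.val : ZMod 29) - (i.val : ZMod 29))) * d ≠ 1 := by
  revert d i j
  decide +kernel

/-- The listed blocks form a family of 29-product blocks over `ZMod 29` in which every
block has exactly 5 elements;
hence κ(29) ≥ 5. -/
theorem kappa_twentynine_ge_five :
    let B : ZMod 29 → Finset (ZMod 29) :=
      fun s => [({7,10,13,16,19} : Finset (ZMod 29)), {15,18,21,24,27}, {0,3,6,23,26}, {2,5,8,11,14}, {10,13,16,19,22}, {1,18,21,24,27}, {0,3,6,9,26}, {5,8,11,14,17}, {13,16,19,22,25}, {1,4,21,24,27}, {0,3,6,9,12}, {8,11,14,17,20}, {16,19,22,25,28}, {1,4,7,24,27}, {3,6,9,12,15}, {11,14,17,20,23}, {2,19,22,25,28}, {1,4,7,10,27}, {6,9,12,15,18}, {14,17,20,23,26}, {2,5,22,25,28}, {1,4,7,10,13}, {9,12,15,18,21}, {0,17,20,23,26}, {2,5,8,25,28}, {4,7,10,13,16}, {12,15,18,21,24},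 {0,3,20,23,26}, {2,5,8,11,28}].getD s.val ∅
    (∀ r s : ZMod 29, ∀ a ∈ B r, ∀ b ∈ B s, (b - a) * (s - r) ≠ 1) ∧
    (∀ s : ZMod 29, (B s).card = 5) := by
  intro B
  have mem_block : ∀ s : ZMod 29, ∀ b ∈ B s, ∃ j : Fin 5, b = 7 + 8 * s + 3 * (j.val : ZMod 29) := by
    decide +kernel
  refine ⟨fun r s a ha b hb h => ?_, by decide +kernel⟩
  obtain ⟨i, rfl⟩ := mem_block r a ha
  obtain ⟨j, rfl⟩ := mem_block s b hb
  refine mul_progression_sub_ne_one (s - r) i j ?_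
  rw [← h]
  ring
end
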